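/- arXiv:2505.00882 — 2 statements merged into one kernel-verified Lean document; each statement's English description precedes it below -/
import Mathlib

section
/- If ρ is a state in 𝔖(ℋ) with finite von Neumann entropy, then S(ρ) − S(σ) ≤ S̃(ρ∧εI) + h↑(ε) for any state σ ∈ 𝔖(ℋ) such that ½‖ρ−σ‖₁ ≤ ε ∈ (0,1]. Moreover, this semicontinuity bound is faithful: S̃(ρ∧εI) + h↑(ε) → 0 as ε → 0. -/
open scoped ENNReal InnerProductSpace
open MeasureTheory

noncomputable section

namespace AFW

attribute [local instance] Classical.propDecidable

variable {𝓗 : Type*} [NormedAddCommGroup 𝓗] [InnerProductSpace ℂ 𝓗] [CompleteSpace 𝓗]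

/-- Trace-type functional: on positive operators it is the trace; on self-adjoint
trace-class operators it is the trace norm `‖·‖₁`. -/
def trNorm (T : 𝓗 →L[ℂ] 𝓗) : ℝ≥0∞ :=
  ⨆ (s : Set 𝓗) (_ : Orthonormal ℂ (Subtype.val : s → 𝓗)),
    ∑' x : s, (‖⟪(x : 𝓗), T x⟫_ℂ‖₊ : ℝ≥0∞)

/-- `ρ` is a quantum state: a positive (trace-class) operator with unit trace. -/
def IsState (ρ : 𝓗 →L[ℂ] 𝓗) : Prop := ρ.IsPositive ∧ trNorm ρ = 1

/-- `ρ ∧ εI` (spectral cut-off from above). -/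
def cut (ρ : 𝓗 →L[ℂ] 𝓗) (ε : ℝ) : 𝓗 →L[ℂ] 𝓗 := cfc (fun x : ℝ => min x ε) ρ

/-- `[ρ − εI]₊`. -/
def cutAbove (ρ : 𝓗 →L[ℂ] 𝓗) (ε : ℝ) : 𝓗 →L[ℂ] 𝓗 := cfc (fun x : ℝ => max (x - ε) 0) ρ

/-- positive part `[T]₊` of a self-adjoint operator. -/
def posP (T : 𝓗 →L[ℂ] 𝓗) : 𝓗 →L[ℂ] 𝓗 := cfc (fun x : ℝ => max x 0) T

/-- negative part `[T]₋` of a self-adjoint operator. -/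
def negP (T : 𝓗 →L[ℂ] 𝓗) : 𝓗 →L[ℂ] 𝓗 := cfc (fun x : ℝ => max (-x) 0) T

def sqrtOp (T : 𝓗 →L[ℂ] 𝓗) : 𝓗 →L[ℂ] 𝓗 := cfc Real.sqrt T

def eta (x : ℝ) : ℝ := -(x * Real.log x)

/-- The von Neumann entropy `S(ρ) = Tr η(ρ)`, with values in `[0,+∞]`. -/
def entropy (ρ : 𝓗 →L[ℂ] 𝓗) : ℝ≥0∞ := trNorm (cfc eta ρ)

/-- Homogeneous extension `S̃` of the von Neumann entropy to the positive cone. -/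
def entExt (ρ : 𝓗 →L[ℂ] 𝓗) : ℝ≥0∞ :=
  if ρ = 0 then 0 else trNorm ρ * entropy ((trNorm ρ).toReal⁻¹ • ρ)

def binEnt (p : ℝ) : ℝ := eta p + eta (1 - p)

def binEntUp (x : ℝ) : ℝ := if x ≤ 1 / 2 then binEnt x else Real.log 2

def etaUp (x : ℝ) : ℝ := if x ≤ (Real.exp 1)⁻¹ then eta x else (Real.exp 1)⁻¹

/-- nondecreasing modification `a↑` used for control functions. -/
def up (a : ℝ → ℝ) (x : ℝ) : ℝ := if x ≤ 1 / 2 then a x else a (1 / 2)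

/-- Control functions for LAA functions. -/
structure ControlPair (a b : ℝ → ℝ) : Prop where
  conta : ContinuousOn a (Set.Icc 0 1)
  contb : ContinuousOn b (Set.Icc 0 1)
  zeroa : a 0 = 0
  zerob : b 0 = 0
  cva : ConcaveOn ℝ (Set.Icc 0 (1 / 2)) a
  cvb : ConcaveOn ℝ (Set.Icc 0 (1 / 2)) b
  mona : MonotoneOn a (Set.Icc 0 (1 / 2))
  monb : MonotoneOn b (Set.Icc 0 (1 / 2))

/-- `f` is locally almost affine on `S0` with control functions `a`, `b`. -/
def IsLAA (S0 : Set (𝓗 →L[ℂ] 𝓗)) (f : (𝓗 →L[ℂ] 𝓗) → EReal) (a b : ℝ → ℝ) : Prop :=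
  ∀ ρ ∈ S0, ∀ σ ∈ S0, ∀ p : ℝ, 0 ≤ p → p ≤ 1 →
    ((p : EReal) * f ρ + ((1 - p : ℝ) : EReal) * f σ) - ((a p : ℝ) : EReal)
        ≤ f (p • ρ + (1 - p) • σ) ∧
      f (p • ρ + (1 - p) • σ)
        ≤ ((p : EReal) * f ρ + ((1 - p : ℝ) : EReal) * f σ) + ((b p : ℝ) : EReal)

/-- Homogeneous extension of `f` to the cone generated by its domain. -/
def homExt (f : (𝓗 →L[ℂ] 𝓗) → EReal) (T : 𝓗 →L[ℂ] 𝓗) : EReal :=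
  if T = 0 then 0 else (trNorm T : EReal) * f ((trNorm T).toReal⁻¹ • T)

/-- The barycenter `Ω(μ)` of the family `w` with respect to `μ`. -/
def Omega {X : Type*} [MeasurableSpace X] (w : X → 𝓗 →L[ℂ] 𝓗) (μ : Measure X) :
    𝓗 →L[ℂ] 𝓗 := ∫ x, w x ∂μ

/-- The quasi-classical set of states generated by `(X, 𝔉, w)`. -/
def QSet {X : Type*} [MeasurableSpace X] (w : X → 𝓗 →L[ℂ] 𝓗) : Set (𝓗 →L[ℂ] 𝓗) :=
  {ρ | ∃ μ : Measure X, IsProbabilityMeasure μ ∧ ρ = Omega w μ}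

/-- Total variation distance between measures. -/
def TV {X : Type*} [MeasurableSpace X] (μ ν : Measure X) : ℝ≥0∞ :=
  ⨆ (A : Set X) (_ : MeasurableSet A), (μ A - ν A) ⊔ (ν A - μ A)

/-- `Tr H ρ` for a positive operator `H = Σ h_k |τ_k⟩⟨τ_k|` given by discrete spectral data. -/
def energy (h : ℕ → ℝ) (τ : ℕ → 𝓗) (ρ : 𝓗 →L[ℂ] 𝓗) : ℝ≥0∞ :=
  if LinearMap.range (ρ : 𝓗 →ₗ[ℂ] 𝓗) ≤ (Submodule.span ℂ (Set.range τ)).topologicalClosure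
  then ∑' k, ENNReal.ofReal (h k * (⟪τ k, ρ (τ k)⟫_ℂ).re)
  else ⊤

/-- A positive operator with discrete spectral representation `Σ h_k |τ_k⟩⟨τ_k|`
(nondecreasing nonnegative eigenvalue sequence, orthonormal eigenvectors). -/
structure DiscreteOp (h : ℕ → ℝ) (τ : ℕ → 𝓗) : Prop where
  ortho : Orthonormal ℂ τ
  nonneg : ∀ k, 0 ≤ h k
  mono : Monotone h

/-- The Gibbs condition `Tr e^{−βH} < ∞` for all `β > 0`. -/
def GibbsCondition (h : ℕ → ℝ) : Prop := ∀ β : ℝ, 0 < β → Summable fun k => Real.exp (-β * h k)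

/-- `F_H(E) = sup { S(ρ) : Tr Hρ ≤ E }`. -/
def FH (h : ℕ → ℝ) (τ : ℕ → 𝓗) (E : ℝ≥0∞) : ℝ≥0∞ :=
  ⨆ (ϑ : 𝓗 →L[ℂ] 𝓗) (_ : IsState ϑ) (_ : energy h τ ϑ ≤ E), entropy ϑ

/-- `Tr(ρ M)` for positive `ρ`, `M`, computed as `Tr(√ρ M √ρ)`. -/
def trPair (ρ M : 𝓗 →L[ℂ] 𝓗) : ℝ≥0∞ := trNorm (sqrtOp ρ * M * sqrtOp ρ)

/-- classical relative entropy of two finite tuples. -/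
def klFin {n : ℕ} (p q : Fin n → ℝ) : ℝ≥0∞ :=
  if ∀ i, q i = 0 → p i = 0 then
    ENNReal.ofReal (∑ i, if p i = 0 then 0 else p i * Real.log (p i / q i))
  else ⊤

/-- The quantum relative entropy `D(ρ‖σ)`, realized as the supremum of classical
relative entropies of outcome distributions over all finite quantum measurements. -/
def relEnt (ρ σ : 𝓗 →L[ℂ] 𝓗) : ℝ≥0∞ :=
  ⨆ (n : ℕ) (M : Fin n → 𝓗 →L[ℂ] 𝓗) (_ : ∀ i, (M i).IsPositive) (_ : ∑ i, M i = 1),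
    klFin (fun i => (trPair ρ (M i)).toReal) (fun i => (trPair σ (M i)).toReal)

/-- rank of an operator (junk value `0` if infinite). -/
def opRank (T : 𝓗 →L[ℂ] 𝓗) : ℕ := Module.finrank ℂ (LinearMap.range (T : 𝓗 →ₗ[ℂ] 𝓗))

/-- a positive trace-preserving linear map (such as a partial trace). -/
def IsMarginal {𝓚 : Type*} [NormedAddCommGroup 𝓚] [InnerProductSpace ℂ 𝓚] [CompleteSpace 𝓚]
    (Λ : (𝓗 →L[ℂ] 𝓗) →ₗ[ℂ] (𝓚 →L[ℂ] 𝓚)) : Prop :=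
  (∀ T : 𝓗 →L[ℂ] 𝓗, T.IsPositive → (Λ T).IsPositive) ∧
  (∀ T : 𝓗 →L[ℂ] 𝓗, T.IsPositive → trNorm (Λ T) = trNorm T)

end AFW

namespace AFW

open Filter

theorem mul_log_div_le_mul_log_div {a A b B : ℝ} (ha : 0 ≤ a) (haA : a ≤ A) (hab : a ≤ b)
    (h : b - a ≤ B - A) : a * Real.log (A / a) ≤ b * Real.log (B / b) := by
  rcases ha.eq_or_lt with rfl | ha
  · rcases hab.eq_or_lt with rfl | hb
    · simp
    · rw [zero_mul]
      refine mul_nonneg hb.le (Real.log_nonneg ?_)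
      rw [le_div_iff₀ hb]
      linarith
  · have hb : 0 < b := ha.trans_le hab
    have hA : 0 < A := ha.trans_le haA
    have hB : 1 + (A - a) / b ≤ B / b := by
      rw [le_div_iff₀ hb]
      field_simp
      linarith
    have hs : 0 ≤ (A - a) / b := div_nonneg (by linarith) hb.le
    have bern : A / a ≤ (1 + (A - a) / b) ^ (b / a) := by
      have := one_add_mul_self_le_rpow_one_add (s := (A - a) / b) (by linarith)
        (p := b / a) (by rwa [le_div_iff₀ ha, one_mul])
      refine le_trans (le_of_eq ?_) this
      field_simp
      ring
    have hl : Real.log (A / a) ≤ b / a * Real.log (B / b) := by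
      calc Real.log (A / a) ≤ Real.log ((1 + (A - a) / b) ^ (b / a)) :=
            Real.log_le_log (by positivity) bern
        _ = b / a * Real.log (1 + (A - a) / b) := Real.log_rpow (by linarith) _
        _ ≤ b / a * Real.log (B / b) := by
            gcongr
    calc a * Real.log (A / a) ≤ a * (b / a * Real.log (B / b)) := by gcongr
      _ = b * Real.log (B / b) := by field_simp

theorem eta_nonneg {x : ℝ} (h0 : 0 ≤ x) (h1 : x ≤ 1) : 0 ≤ eta x := by
  have := mul_nonneg h0 (neg_nonneg.2 (Real.log_nonpos h0 h1))
  simpa [eta] using this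

theorem eta_add_le {a d A δ : ℝ} (ha : 0 ≤ a) (hd : 0 ≤ d) (haA : a ≤ A) (hdδ : d ≤ δ) :
    eta (a + d) ≤ a * Real.log (A / a) + d * Real.log (δ / d)
      + a * -Real.log A + d * -Real.log δ := by
  have key : ∀ {x y X : ℝ}, 0 ≤ x → 0 ≤ y → x ≤ X →
      -(x * Real.log (x + y)) ≤ x * Real.log (X / x) + x * -Real.log X := by
    intro x y X hx hy hX
    rcases hx.eq_or_lt with rfl | hx
    · simp
    · have h1 : Real.log x ≤ Real.log (x + y) := Real.log_le_log hx (by linarith)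
      rw [Real.log_div (hx.trans_le hX).ne' hx.ne']
      nlinarith
  have h1 := key ha hd haA
  have h2 := key hd ha hdδ
  rw [add_comm d a] at h2
  unfold eta
  linarith

theorem mul_eta_inv_mul {M x : ℝ} (hM : 0 < M) :
    M * eta (M⁻¹ * x) = x * Real.log (M / x) := by
  have : Real.log (M⁻¹ * x) = -Real.log (M / x) := by
    rw [← Real.log_inv, inv_div, div_eq_inv_mul]
  unfold eta
  rw [this]
  field_simp

theorem binEnt_eq_binEntropy (p : ℝ) : binEnt p = Real.binEntropy p := by
  rw [binEnt, eta, eta, Real.binEntropy_eq_negMulLog_add_negMulLog_one_sub]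
  simp only [Real.negMulLog, neg_mul]

theorem binEnt_le_binEntUp {δ ε : ℝ} (h0 : 0 ≤ δ) (h : δ ≤ ε) : binEnt δ ≤ binEntUp ε := by
  unfold binEntUp
  split_ifs with h2
  · rw [binEnt_eq_binEntropy, binEnt_eq_binEntropy]
    refine Real.binEntropy_strictMonoOn.monotoneOn ⟨h0, ?_⟩ ⟨h0.trans h, ?_⟩ h <;>
    norm_num at h2 ⊢ <;> linarith
  · rw [binEnt_eq_binEntropy]
    exact Real.binEntropy_le_log_two

theorem tsum_eta_le {K : Type*} {p q : K → ℝ} (hp0 : ∀ k, 0 ≤ p k) (hq0 : ∀ k, 0 ≤ q k)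
    (hp : HasSum p 1) (hq : HasSum q 1) {ε M : ℝ}
    (hε : ∑' k, max (p k - q k) 0 ≤ ε) (hM : HasSum (fun k => min (p k) ε) M) :
    ∑' k, ENNReal.ofReal (eta (p k)) ≤ ∑' k, ENNReal.ofReal (eta (q k))
      + ∑' k, ENNReal.ofReal (min (p k) ε * Real.log (M / min (p k) ε))
      + ENNReal.ofReal (binEntUp ε) := by
  set a : K → ℝ := fun k => min (p k) (q k) with ha
  set d : K → ℝ := fun k => max (p k - q k) 0 with hd
  have ha0 : ∀ k, 0 ≤ a k := fun k => le_min (hp0 k) (hq0 k)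
  have hd0 : ∀ k, 0 ≤ d k := fun k => le_max_right _ _
  have had : ∀ k, a k + d k = p k := by
    intro k
    simp only [ha, hd]
    rcases le_total (p k) (q k) with h | h
    · rw [min_eq_left h, max_eq_right (by linarith)]; ring
    · rw [min_eq_right h, max_eq_left (by linarith)]; ring
  have hdp : ∀ k, d k ≤ p k := fun k => by linarith [had k, ha0 k]
  have hdsum : Summable d := hp.summable.of_nonneg_of_le hd0 hdp
  set δ := ∑' k, d k with hδ
  have hdS : HasSum d δ := hdsum.hasSum
  have hδ0 : 0 ≤ δ := tsum_nonneg hd0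
  have haS : HasSum a (1 - δ) := by
    refine (hp.sub hdS).congr_fun fun k => ?_
    linarith [had k]
  have hdδ : ∀ k, d k ≤ δ := fun k => le_hasSum hdS k (fun j _ => hd0 j)
  have haA : ∀ k, a k ≤ 1 - δ := fun k => le_hasSum haS k (fun j _ => ha0 j)
  have hqa : ∀ k, q k - a k ≤ 1 - (1 - δ) := fun k =>
    le_hasSum (hq.sub haS) k (fun j _ => sub_nonneg.2 (min_le_right _ _))
  have hdm : ∀ k, d k ≤ min (p k) ε := fun k => le_min (hdp k) ((hdδ k).trans hε)
  have hmd : ∀ k, min (p k) ε - d k ≤ M - δ := fun k =>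
    le_hasSum (hM.sub hdS) k (fun j _ => sub_nonneg.2 (hdm j))
  by_cases hK : IsEmpty K
  · simp
  have hδ1 : δ ≤ 1 := by
    obtain ⟨k⟩ := not_isEmpty_iff.1 hK
    linarith [ha0 k, haA k]
  have hq1 : ∀ k, q k ≤ 1 := fun k => le_hasSum hq k (fun j _ => hq0 j)
  have hla : 0 ≤ -Real.log (1 - δ) :=
    neg_nonneg.2 (Real.log_nonpos (by linarith) (by linarith))
  have hld : 0 ≤ -Real.log δ := neg_nonneg.2 (Real.log_nonpos hδ0 hδ1)
  have h1 : ∀ k, a k * Real.log ((1 - δ) / a k) ≤ eta (q k) := by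
    intro k
    refine (mul_log_div_le_mul_log_div (ha0 k) (haA k) (min_le_right _ _) (hqa k)).trans_eq ?_
    simp [eta]
  have h2 : ∀ k, d k * Real.log (δ / d k) ≤ min (p k) ε * Real.log (M / min (p k) ε) := fun k =>
    mul_log_div_le_mul_log_div (hd0 k) (hdδ k) (hdm k) (hmd k)
  have hpt : ∀ k, ENNReal.ofReal (eta (p k)) ≤ ENNReal.ofReal (eta (q k))
      + ENNReal.ofReal (min (p k) ε * Real.log (M / min (p k) ε))
      + (ENNReal.ofReal (a k * -Real.log (1 - δ)) + ENNReal.ofReal (d k * -Real.log δ)) := by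
    intro k
    refine le_trans (ENNReal.ofReal_le_ofReal (q := eta (q k)
      + min (p k) ε * Real.log (M / min (p k) ε)
      + (a k * -Real.log (1 - δ) + d k * -Real.log δ)) ?_) ?_
    · have := eta_add_le (ha0 k) (hd0 k) (haA k) (hdδ k)
      rw [had k] at this
      linarith [h1 k, h2 k]
    · refine ENNReal.ofReal_add_le.trans (add_le_add ENNReal.ofReal_add_le ENNReal.ofReal_add_le)
  refine (ENNReal.tsum_le_tsum hpt).trans ?_
  rw [ENNReal.tsum_add, ENNReal.tsum_add]
  gcongr
  have haL := haS.mul_right (-Real.log (1 - δ))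
  have hdL := hdS.mul_right (-Real.log δ)
  rw [ENNReal.tsum_add, ← ENNReal.ofReal_tsum_of_nonneg (fun k => mul_nonneg (ha0 k) hla)
    haL.summable, ← ENNReal.ofReal_tsum_of_nonneg (fun k => mul_nonneg (hd0 k) hld)
    hdL.summable, haL.tsum_eq, hdL.tsum_eq, ← ENNReal.ofReal_add
      (mul_nonneg (by linarith) hla) (mul_nonneg hδ0 hld)]
  refine ENNReal.ofReal_le_ofReal (le_trans (le_of_eq ?_) (binEnt_le_binEntUp hδ0 hε))
  simp only [binEnt, eta]
  ring

theorem mul_log_div_nonneg {x M : ℝ} (h0 : 0 ≤ x) (h : x ≤ M) : 0 ≤ x * Real.log (M / x) := by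
  rcases h0.eq_or_lt with rfl | hx
  · simp
  · exact mul_nonneg h0 (Real.log_nonneg ((one_le_div hx).2 h))

theorem mul_log_div_le_eta {x M : ℝ} (h0 : 0 ≤ x) (h : x ≤ M) (hM : M ≤ 1) :
    x * Real.log (M / x) ≤ eta x := by
  rcases h0.eq_or_lt with rfl | hx
  · simp [eta]
  · rw [Real.log_div (hx.trans_le h).ne' hx.ne', eta]
    nlinarith [Real.log_nonpos (h0.trans h) hM]

theorem eta_min_le {x ε : ℝ} (hx0 : 0 ≤ x) (hx1 : x ≤ 1) (hε : 0 ≤ ε) (hε1 : ε ≤ 1) :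
    eta (min x ε) ≤ eta x + x := by
  rcases le_total x ε with h | h
  · rw [min_eq_left h]; linarith
  · rw [min_eq_right h]
    have h1 := mul_log_div_le_mul_log_div (A := 1) (B := 1 + (x - ε)) hε hε1 h (by linarith)
    rcases hx0.eq_or_lt with rfl | hx
    · rw [le_antisymm h hε]; simp
    · rw [Real.log_div (by linarith) hx.ne', one_div, Real.log_inv] at h1
      have h2 := Real.log_le_sub_one_of_pos (x := 1 + (x - ε)) (by linarith)
      unfold eta
      nlinarith

theorem continuous_eta : Continuous eta := Real.continuous_mul_log.neg

theorem hasSum_min {K : Type*} {p : K → ℝ} (hp0 : ∀ k, 0 ≤ p k) (hp : Summable p) {ε : ℝ}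
    (hε : 0 ≤ ε) : HasSum (fun k => min (p k) ε) (∑' k, min (p k) ε) :=
  (hp.of_nonneg_of_le (fun k => le_min (hp0 k) hε) (fun _ => min_le_left _ _)).hasSum

theorem tendsto_tsum_mul_log_div_min {K : Type*} {p : K → ℝ} (hp0 : ∀ k, 0 ≤ p k)
    (hp : HasSum p 1) (hfin : ∑' k, ENNReal.ofReal (eta (p k)) ≠ ⊤) :
    Tendsto (fun ε : ℝ => ∑' k, ENNReal.ofReal
        (min (p k) ε * Real.log ((∑' j, min (p j) ε) / min (p k) ε)))
      (nhdsWithin 0 (Set.Ioi 0)) (nhds 0) := by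
  have hp1 : ∀ k, p k ≤ 1 := fun k => le_hasSum hp k (fun j _ => hp0 j)
  have heta0 : ∀ k, 0 ≤ eta (p k) := fun k => eta_nonneg (hp0 k) (hp1 k)
  have hsum : Summable (fun k => eta (p k)) := by
    have := ENNReal.summable_toReal hfin
    simpa only [ENNReal.toReal_ofReal (heta0 _)] using this
  have hM1 : ∀ ε : ℝ, 0 ≤ ε → ∑' j, min (p j) ε ≤ 1 := fun ε hε =>
    hasSum_le (fun k => min_le_left _ _) (hasSum_min hp0 hp.summable hε) hp
  have hmM : ∀ ε : ℝ, 0 ≤ ε → ∀ k, min (p k) ε ≤ ∑' j, min (p j) ε := fun ε hε k =>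
    le_hasSum (hasSum_min hp0 hp.summable hε) k (fun j _ => le_min (hp0 j) hε)
  have hnn : ∀ ε : ℝ, 0 ≤ ε → ∀ k,
      0 ≤ min (p k) ε * Real.log ((∑' j, min (p j) ε) / min (p k) ε) := fun ε hε k =>
    mul_log_div_nonneg (le_min (hp0 k) hε) (hmM ε hε k)
  have hle : ∀ ε : ℝ, 0 ≤ ε → ∀ k,
      min (p k) ε * Real.log ((∑' j, min (p j) ε) / min (p k) ε) ≤ eta (min (p k) ε) :=
    fun ε hε k => mul_log_div_le_eta (le_min (hp0 k) hε) (hmM ε hε k) (hM1 ε hε)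
  have hbd : ∀ ε : ℝ, 0 ≤ ε → ε ≤ 1 → ∀ k,
      ‖min (p k) ε * Real.log ((∑' j, min (p j) ε) / min (p k) ε)‖ ≤ eta (p k) + p k := by
    intro ε hε hε1 k
    rw [Real.norm_of_nonneg (hnn ε hε k)]
    exact (hle ε hε k).trans (eta_min_le (hp0 k) (hp1 k) hε hε1)
  have hpos : ∀ᶠ ε : ℝ in nhdsWithin 0 (Set.Ioi 0), 0 ≤ ε :=
    eventually_nhdsWithin_of_forall fun ε hε => le_of_lt hε
  have hone : ∀ᶠ ε : ℝ in nhdsWithin 0 (Set.Ioi 0), ε ≤ 1 :=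
    eventually_nhdsWithin_of_eventually_nhds (eventually_le_nhds one_pos)
  have hlim : ∀ k, Tendsto (fun ε : ℝ =>
      min (p k) ε * Real.log ((∑' j, min (p j) ε) / min (p k) ε))
      (nhdsWithin 0 (Set.Ioi 0)) (nhds 0) := by
    intro k
    have h0 : Tendsto (fun ε : ℝ => eta (min (p k) ε)) (nhdsWithin 0 (Set.Ioi 0)) (nhds 0) := by
      have hc : Continuous fun ε : ℝ => eta (min (p k) ε) :=
        continuous_eta.comp (continuous_const.min continuous_id)
      have := hc.tendsto 0
      rw [min_eq_right (hp0 k)] at this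
      simpa [eta] using this.mono_left nhdsWithin_le_nhds
    refine tendsto_of_tendsto_of_tendsto_of_le_of_le' tendsto_const_nhds h0 ?_ ?_
    · filter_upwards [hpos] with ε hε using hnn ε hε k
    · filter_upwards [hpos] with ε hε using hle ε hε k
  have hmain := tendsto_tsum_of_dominated_convergence (hsum.add hp.summable) hlim
    (by filter_upwards [hpos, hone] with ε hε hε1 using hbd ε hε hε1)
  rw [tsum_zero] at hmain
  have := ENNReal.tendsto_ofReal hmain
  rw [ENNReal.ofReal_zero] at this
  refine this.congr' ?_
  filter_upwards [hpos, hone] with ε hε hε1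
  refine ENNReal.ofReal_tsum_of_nonneg (hnn ε hε) ?_
  exact Summable.of_norm_bounded (hsum.add hp.summable) (hbd ε hε hε1)

theorem tendsto_binEntUp :
    Tendsto (fun ε : ℝ => ENNReal.ofReal (binEntUp ε)) (nhdsWithin 0 (Set.Ioi 0)) (nhds 0) := by
  have h : Tendsto (fun ε : ℝ => ENNReal.ofReal (binEnt ε)) (nhdsWithin 0 (Set.Ioi 0))
      (nhds 0) := by
    have := ENNReal.tendsto_ofReal (Real.binEntropy_continuous.tendsto 0)
    rw [Real.binEntropy_zero, ENNReal.ofReal_zero] at this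
    refine (this.mono_left nhdsWithin_le_nhds).congr fun ε => ?_
    rw [binEnt_eq_binEntropy]
  refine h.congr' ?_
  filter_upwards [eventually_nhdsWithin_of_eventually_nhds
    (eventually_le_nhds (b := (1 / 2 : ℝ)) (by norm_num))] with ε hε
  rw [binEntUp, if_pos hε]

section

variable {𝓗 : Type*} [NormedAddCommGroup 𝓗] [InnerProductSpace ℂ 𝓗] [CompleteSpace 𝓗]

omit [CompleteSpace 𝓗] in
theorem mem_spectrum_of_apply_eq_smul {T : 𝓗 →L[ℂ] 𝓗} {t : ℝ} {x : 𝓗} (hx : x ≠ 0)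
    (h : T x = (t : ℂ) • x) : t ∈ spectrum ℝ T := by
  rw [spectrum.mem_iff]
  rintro ⟨u, hu⟩
  have h0 : (u : 𝓗 →L[ℂ] 𝓗) x = 0 := by
    rw [hu, Algebra.algebraMap_eq_smul_one]
    simp [h]
  apply hx
  calc x = ((u⁻¹ : (𝓗 →L[ℂ] 𝓗)ˣ) * u : 𝓗 →L[ℂ] 𝓗) x := by simp
    _ = (u⁻¹ : (𝓗 →L[ℂ] 𝓗)ˣ).val ((u : 𝓗 →L[ℂ] 𝓗) x) := rfl
    _ = 0 := by rw [h0, map_zero]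

theorem cfc_apply_of_apply_eq_smul {T : 𝓗 →L[ℂ] 𝓗} (hT : IsSelfAdjoint T) {t : ℝ} {x : 𝓗}
    (hx : x ≠ 0) (h : T x = (t : ℂ) • x) {f : ℝ → ℝ} (hf : Continuous f) :
    cfc f T x = (f t : ℂ) • x := by
  have ht := mem_spectrum_of_apply_eq_smul hx h
  rw [cfc_apply f T hT hf.continuousOn]
  have key : ∀ g : C(spectrum ℝ T, ℝ), cfcHom hT g x = (g ⟨t, ht⟩ : ℂ) • x := by
    intro g
    have hid : cfcHom hT (ContinuousMap.restrict (spectrum ℝ T) (.id ℝ)) = T := cfcHom_id hT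
    induction g using ContinuousMap.induction_on_of_compact with
    | const r =>
      have : ContinuousMap.const (spectrum ℝ T) r = algebraMap ℝ _ r := rfl
      rw [this, AlgHomClass.commutes, Algebra.algebraMap_eq_smul_one]
      simp
    | id => rw [hid, h]; rfl
    | star_id => rw [star_trivial, hid, h]; rfl
    | add f g hf hg => rw [map_add, add_apply, hf, hg]; simp [add_smul]
    | mul f g hf hg =>
      rw [map_mul, mul_apply_eq_comp, hg, map_smul, hf]
      rw [smul_smul, mul_comm, ContinuousMap.mul_apply, Complex.ofReal_mul]
    | frequently f hfr =>
      have hcl : IsClosed {g : C(spectrum ℝ T, ℝ) | cfcHom hT g x = (g ⟨t, ht⟩ : ℂ) • x} := by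
        refine isClosed_eq ?_ ?_
        · exact (ContinuousLinearMap.apply ℂ 𝓗 x).continuous.comp (cfcHom_continuous hT)
        · exact (Complex.continuous_ofReal.comp (continuous_eval_const (⟨t, ht⟩ : spectrum ℝ T))).smul
            continuous_const
      exact hcl.closure_subset (mem_closure_iff_frequently.2 hfr)
  exact key _

omit [CompleteSpace 𝓗] in
theorem hasSum_norm_inner_sq {ι : Type*} (b : HilbertBasis ι ℂ 𝓗) (x : 𝓗) :
    HasSum (fun i => ‖⟪b i, x⟫_ℂ‖ ^ 2) (‖x‖ ^ 2) := by
  have h := Complex.hasSum_re (b.hasSum_inner_mul_inner x x)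
  rw [inner_self_eq_norm_sq_to_K] at h
  convert h using 1
  · ext i
    rw [← inner_conj_symm x (b i), Complex.conj_mul']
    norm_cast
  · norm_cast

omit [CompleteSpace 𝓗] in
theorem tsum_ofReal_norm_inner_sq {ι : Type*} (b : HilbertBasis ι ℂ 𝓗) (x : 𝓗) :
    ∑' i, ENNReal.ofReal (‖⟪b i, x⟫_ℂ‖ ^ 2) = ENNReal.ofReal (‖x‖ ^ 2) := by
  rw [← ENNReal.ofReal_tsum_of_nonneg (fun i => by positivity) (hasSum_norm_inner_sq b x).summable,
    (hasSum_norm_inner_sq b x).tsum_eq]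

/-- The Hilbert basis `b` diagonalizes the self-adjoint operator `T`, with eigenvalues `t`. -/
structure IsEigenbasis {ι : Type*} (T : 𝓗 →L[ℂ] 𝓗) (b : HilbertBasis ι ℂ 𝓗) (t : ι → ℝ) :
    Prop where
  isSelfAdjoint : IsSelfAdjoint T
  apply_eq : ∀ i, T (b i) = (t i : ℂ) • b i

namespace IsEigenbasis

variable {ι : Type*} {T : 𝓗 →L[ℂ] 𝓗} {b : HilbertBasis ι ℂ 𝓗} {t : ι → ℝ}

protected theorem cfc (h : IsEigenbasis T b t) {f : ℝ → ℝ} (hf : Continuous f) :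
    IsEigenbasis (cfc f T) b (fun i => f (t i)) where
  isSelfAdjoint := cfc_predicate f T
  apply_eq i := cfc_apply_of_apply_eq_smul h.isSelfAdjoint (b.orthonormal.ne_zero i)
    (h.apply_eq i) hf

protected theorem smul (h : IsEigenbasis T b t) (r : ℝ) :
    IsEigenbasis (r • T) b (fun i => r * t i) where
  isSelfAdjoint := (IsSelfAdjoint.all r).smul h.isSelfAdjoint
  apply_eq i := by
    rw [smul_apply, h.apply_eq, ← smul_assoc]
    simp

theorem hasSum_inner (h : IsEigenbasis T b t) (x : 𝓗) :
    HasSum (fun i => ((t i * ‖⟪b i, x⟫_ℂ‖ ^ 2 : ℝ) : ℂ)) ⟪x, T x⟫_ℂ := by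
  refine (b.hasSum_inner_mul_inner x (T x)).congr_fun fun i => ?_
  have h1 : ⟪b i, T x⟫_ℂ = t i * ⟪b i, x⟫_ℂ := by
    refine (h.isSelfAdjoint.isSymmetric (b i) x).symm.trans ?_
    rw [ContinuousLinearMap.coe_coe, h.apply_eq, inner_smul_left, Complex.conj_ofReal]
  rw [h1, ← inner_conj_symm x (b i), mul_left_comm, Complex.conj_mul']
  push_cast
  ring

theorem hasSum_re_inner (h : IsEigenbasis T b t) (x : 𝓗) :
    HasSum (fun i => t i * ‖⟪b i, x⟫_ℂ‖ ^ 2) (⟪x, T x⟫_ℂ).re := by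
  simpa only [Complex.ofReal_re] using Complex.hasSum_re (h.hasSum_inner x)

theorem inner_apply_self (h : IsEigenbasis T b t) (i : ι) : ⟪b i, T (b i)⟫_ℂ = t i := by
  rw [h.apply_eq, inner_smul_right, inner_self_eq_norm_sq_to_K, b.orthonormal.1 i]
  simp

theorem nonneg (h : IsEigenbasis T b t) (hT : T.IsPositive) (i : ι) : 0 ≤ t i := by
  have := hT.inner_nonneg_right (b i)
  rw [h.inner_apply_self] at this
  exact_mod_cast this

theorem trNorm_eq (h : IsEigenbasis T b t) : trNorm T = ∑' i, ENNReal.ofReal |t i| := by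
  apply le_antisymm
  · refine iSup₂_le fun s hs => ?_
    calc ∑' x : s, (‖⟪(x : 𝓗), T x⟫_ℂ‖₊ : ℝ≥0∞)
        ≤ ∑' x : s, ∑' i, ENNReal.ofReal |t i| * ENNReal.ofReal (‖⟪(x : 𝓗), b i⟫_ℂ‖ ^ 2) := by
          refine ENNReal.tsum_le_tsum fun x => ?_
          rw [← enorm_eq_nnnorm, ← (h.hasSum_inner x).tsum_eq]
          refine le_trans enorm_tsum_le_tsum_enorm (le_of_eq ?_)
          refine tsum_congr fun i => ?_
          rw [← ENNReal.ofReal_mul (abs_nonneg _), ← ofReal_norm, Complex.norm_real,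
            norm_mul, Real.norm_eq_abs, norm_pow, norm_norm, norm_inner_symm]
      _ = ∑' i, ENNReal.ofReal |t i| * ∑' x : s, ENNReal.ofReal (‖⟪(x : 𝓗), b i⟫_ℂ‖ ^ 2) := by
          rw [ENNReal.tsum_comm]
          simp_rw [ENNReal.tsum_mul_left]
      _ ≤ ∑' i, ENNReal.ofReal |t i| := by
          refine ENNReal.tsum_le_tsum fun i => mul_le_of_le_one_right' ?_
          rw [← ENNReal.ofReal_tsum_of_nonneg (fun _ => by positivity)
            (hs.inner_products_summable (b i))]
          refine ENNReal.ofReal_le_one.2 ((hs.tsum_inner_products_le (b i)).trans_eq ?_)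
          rw [b.orthonormal.1 i, one_pow]
  · refine le_trans (le_of_eq ?_) (le_iSup₂_of_le (Set.range b) b.orthonormal.toSubtypeRange le_rfl)
    rw [tsum_range (fun x => (‖⟪x, T x⟫_ℂ‖₊ : ℝ≥0∞)) b.orthonormal.linearIndependent.injective]
    refine tsum_congr fun i => ?_
    rw [h.inner_apply_self, ← enorm_eq_nnnorm, ← ofReal_norm, Complex.norm_real,
      Real.norm_eq_abs]

theorem tsum_inner_eq (h : IsEigenbasis T b t) (ht : ∀ i, 0 ≤ t i) {κ : Type*}
    (c : HilbertBasis κ ℂ 𝓗) :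
    ∑' k, ENNReal.ofReal (⟪c k, T (c k)⟫_ℂ).re = ∑' i, ENNReal.ofReal (t i) := by
  have h1 : ∀ k, ENNReal.ofReal (⟪c k, T (c k)⟫_ℂ).re
      = ∑' i, ENNReal.ofReal (t i) * ENNReal.ofReal (‖⟪c k, b i⟫_ℂ‖ ^ 2) := by
    intro k
    rw [← (h.hasSum_re_inner (c k)).tsum_eq, ENNReal.ofReal_tsum_of_nonneg
      (fun i => mul_nonneg (ht i) (by positivity)) (h.hasSum_re_inner (c k)).summable]
    refine tsum_congr fun i => ?_
    rw [ENNReal.ofReal_mul (ht i), norm_inner_symm]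
  simp_rw [h1]
  rw [ENNReal.tsum_comm]
  simp_rw [ENNReal.tsum_mul_left, tsum_ofReal_norm_inner_sq c, b.orthonormal.1]
  simp

end IsEigenbasis

omit [CompleteSpace 𝓗] in
theorem inner_eq_zero_of_hilbertBasis {U : Submodule ℂ 𝓗} {ι : Type*} (e : HilbertBasis ι ℂ U)
    {x : 𝓗} (h : ∀ i, ⟪x, (e i : 𝓗)⟫_ℂ = 0) : x ∈ Uᗮ := by
  rw [Submodule.mem_orthogonal']
  intro u hu
  have hs := ((e.hasSum_repr ⟨u, hu⟩).mapL U.subtypeL).mapL (innerSL ℂ x)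
  refine hs.unique (hasSum_zero.congr_fun fun i => ?_)
  rw [map_smul, map_smul, innerSL_apply_apply, Submodule.subtypeL_apply, h, smul_zero]

theorem exists_isEigenbasis.{u} {𝓗 : Type u} [NormedAddCommGroup 𝓗] [InnerProductSpace ℂ 𝓗]
    [CompleteSpace 𝓗] {T : 𝓗 →L[ℂ] 𝓗} (hT : IsSelfAdjoint T) (hc : IsCompactOperator T) :
    ∃ (ι : Type u) (b : HilbertBasis ι ℂ 𝓗) (t : ι → ℝ), IsEigenbasis T b t := by
  have hsym : (T : 𝓗 →ₗ[ℂ] 𝓗).IsSymmetric := hT.isSymmetric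
  have hcomplete : ∀ μ : ℂ, CompleteSpace (Module.End.eigenspace (T : 𝓗 →ₗ[ℂ] 𝓗) μ) := by
    intro μ
    have : ((Module.End.eigenspace (T : 𝓗 →ₗ[ℂ] 𝓗) μ : Submodule ℂ 𝓗) : Set 𝓗)
        = {x | T x = μ • x} := by
      ext x
      exact Module.End.mem_eigenspace_iff
    have hcl : IsClosed {x | T x = μ • x} := isClosed_eq T.continuous (continuous_const_smul μ)
    rw [← this] at hcl
    exact hcl.completeSpace_coe
  choose w e he using fun μ : ℂ =>
    exists_hilbertBasis ℂ (Module.End.eigenspace (T : 𝓗 →ₗ[ℂ] 𝓗) μ)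
  have hon : Orthonormal ℂ fun a : Σ μ, w μ => ((e a.1 a.2 : _) : 𝓗) :=
    hsym.orthogonalFamily_eigenspaces.orthonormal_sigma_orthonormal
      (v_family := fun μ => e μ) (fun μ => (e μ).orthonormal)
  have hbot : (Submodule.span ℂ (Set.range fun a : Σ μ, w μ => ((e a.1 a.2 : _) : 𝓗)))ᗮ = ⊥ := by
    rw [eq_bot_iff, ← ContinuousLinearMap.orthogonalComplement_iSup_eigenspaces_eq_bot hc hsym]
    intro x hx
    rw [← Submodule.iInf_orthogonal, Submodule.mem_iInf]
    exact fun μ => inner_eq_zero_of_hilbertBasis (e μ) fun i =>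
      (Submodule.mem_orthogonal' _ _).1 hx _ (Submodule.subset_span ⟨⟨μ, i⟩, rfl⟩)
  have key : ∀ a : Σ μ, w μ, T (e a.1 a.2) = ((a.1.re : ℝ) : ℂ) • (e a.1 a.2 : 𝓗) := by
    rintro ⟨μ, i⟩
    have hmem := (e μ i).2
    have hne : (e μ i : 𝓗) ≠ 0 := fun h0 => (e μ).orthonormal.ne_zero i (Subtype.ext h0)
    have hμ := hsym.conj_eigenvalue_eq_self
      (Module.End.hasEigenvalue_of_hasEigenvector ⟨hmem, hne⟩)
    rw [Complex.conj_eq_iff_re.1 hμ]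
    exact Module.End.mem_eigenspace_iff.1 hmem
  let b := HilbertBasis.mkOfOrthogonalEqBot hon hbot
  have hb : ∀ a, b a = (e a.1 a.2 : 𝓗) :=
    congrFun (HilbertBasis.coe_mkOfOrthogonalEqBot hon hbot)
  refine ⟨_, b, fun a => a.1.re, hT, fun a => ?_⟩
  rw [hb]
  exact key a

omit [CompleteSpace 𝓗] in
theorem isCompactOperator_smulRight (f : 𝓗 →L[ℂ] ℂ) (v : 𝓗) :
    IsCompactOperator (f.smulRight v) := by
  have h : IsCompactOperator f := isCompactOperator_of_locallyCompactSpace_dom f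
  exact h.clm_comp (ContinuousLinearMap.toSpanSingleton ℂ v)

theorem isCompactOperator_of_summable_norm_sq {ι : Type*} (b : HilbertBasis ι ℂ 𝓗)
    {S : 𝓗 →L[ℂ] 𝓗} (hS : IsSelfAdjoint S) (h : Summable fun i => ‖S (b i)‖ ^ 2) :
    IsCompactOperator S := by
  classical
  let A : Finset ι → 𝓗 →L[ℂ] 𝓗 := fun F => ∑ i ∈ F, (innerSL ℂ (S (b i))).smulRight (b i)
  have hA : ∀ F, IsCompactOperator (A F) := fun F =>
    Submodule.sum_mem (compactOperator (RingHom.id ℂ) 𝓗 𝓗)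
      fun i _ => isCompactOperator_smulRight _ _
  have hsub : ∀ F x j, ⟪b j, (S - A F) x⟫_ℂ = if j ∈ F then 0 else ⟪S (b j), x⟫_ℂ := by
    intro F x j
    have h1 : ⟪b j, A F x⟫_ℂ = if j ∈ F then ⟪S (b j), x⟫_ℂ else 0 := by
      simp [A, sum_apply, orthonormal_iff_ite.1 b.orthonormal]
    have h2 : ⟪b j, S x⟫_ℂ = ⟪S (b j), x⟫_ℂ := (hS.isSymmetric (b j) x).symm
    rw [sub_apply, inner_sub_right, h1, h2]
    split_ifs <;> simp
  have hle : ∀ F, ‖S - A F‖ ≤ √(∑' i : { i // i ∉ F }, ‖S (b i)‖ ^ 2) := by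
    intro F
    refine ContinuousLinearMap.opNorm_le_bound _ (Real.sqrt_nonneg _) fun x => ?_
    refine le_of_sq_le_sq ?_ (by positivity)
    rw [mul_pow, Real.sq_sqrt (tsum_nonneg fun i => by positivity), ← tsum_mul_right]
    have h1 : HasSum (fun j : { i // i ∉ F } => ‖⟪S (b j), x⟫_ℂ‖ ^ 2) (‖(S - A F) x‖ ^ 2) := by
      refine (hasSum_subtype_iff_of_support_subset (s := {i | i ∉ F})
        (f := fun j => ‖⟪b j, (S - A F) x⟫_ℂ‖ ^ 2) ?_).2 (hasSum_norm_inner_sq b _) |>.congr_fun ?_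
      · intro j hj hjF
        rw [Function.mem_support, hsub, if_pos hjF] at hj
        simp at hj
      · intro j
        simp only [Function.comp_apply]
        rw [hsub, if_neg j.2]
    refine hasSum_le (fun j => ?_) h1 ((h.subtype _).mul_right _).hasSum
    simp only [Function.comp_apply]
    rw [← mul_pow]
    exact pow_le_pow_left₀ (norm_nonneg _) (norm_inner_le_norm _ _) 2
  refine isCompactOperator_of_tendsto (F := A) (l := Filter.atTop) ?_ (.of_forall hA)
  rw [tendsto_iff_norm_sub_tendsto_zero]
  have h0 := (Real.continuous_sqrt.tendsto 0).comp
    (tendsto_tsum_compl_atTop_zero fun i => ‖S (b i)‖ ^ 2)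
  rw [Real.sqrt_zero] at h0
  refine squeeze_zero (fun _ => norm_nonneg _) (fun F => ?_) h0
  rw [norm_sub_rev]
  exact hle F

theorem isCompactOperator_of_tsum_inner_ne_top {ι : Type*} (b : HilbertBasis ι ℂ 𝓗)
    {T : 𝓗 →L[ℂ] 𝓗} (hT : T.IsPositive)
    (h : ∑' i, ENNReal.ofReal (⟪b i, T (b i)⟫_ℂ).re ≠ ⊤) : IsCompactOperator T := by
  have h0 : 0 ≤ T := (ContinuousLinearMap.nonneg_iff_isPositive T).2 hT
  have hS : IsSelfAdjoint (CFC.sqrt T) := IsSelfAdjoint.of_nonneg (CFC.sqrt_nonneg T)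
  have hmul : CFC.sqrt T * CFC.sqrt T = T := CFC.sqrt_mul_sqrt_self T h0
  have hn : ∀ i, (⟪b i, T (b i)⟫_ℂ).re = ‖CFC.sqrt T (b i)‖ ^ 2 := by
    intro i
    have h1 : ⟪b i, T (b i)⟫_ℂ = ⟪CFC.sqrt T (b i), CFC.sqrt T (b i)⟫_ℂ := by
      conv_lhs => rw [← hmul]
      exact (hS.isSymmetric (b i) (CFC.sqrt T (b i))).symm
    rw [h1, inner_self_eq_norm_sq_to_K]
    norm_cast
  simp_rw [hn] at h
  have hc := isCompactOperator_of_summable_norm_sq b hS (by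
    refine (ENNReal.summable_toReal h).congr fun i => ?_
    rw [ENNReal.toReal_ofReal (by positivity)])
  have := hc.comp_clm (CFC.sqrt T)
  rw [← hmul]
  exact this

theorem hasSum_of_tsum_ofReal_eq {ι : Type*} {t : ι → ℝ} (ht : ∀ i, 0 ≤ t i) {M : ℝ}
    (hM : 0 ≤ M) (h : ∑' i, ENNReal.ofReal (t i) = ENNReal.ofReal M) : HasSum t M := by
  have hs : Summable t := (ENNReal.summable_toReal (h ▸ ENNReal.ofReal_ne_top)).congr fun i => by
    rw [ENNReal.toReal_ofReal (ht i)]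
  rw [← ENNReal.ofReal_tsum_of_nonneg ht hs,
    ENNReal.ofReal_eq_ofReal_iff (tsum_nonneg ht) hM] at h
  exact h ▸ hs.hasSum

theorem tsum_ofReal_eq_of_hasSum {ι : Type*} {t : ι → ℝ} {M : ℝ} (h : HasSum t M)
    (ht : ∀ i, 0 ≤ t i) : ∑' i, ENNReal.ofReal (t i) = ENNReal.ofReal M := by
  rw [← ENNReal.ofReal_tsum_of_nonneg ht h.summable, h.tsum_eq]

theorem exists_isEigenbasis_of_tsum_inner.{u} {𝓗 : Type u} [NormedAddCommGroup 𝓗]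
    [InnerProductSpace ℂ 𝓗] [CompleteSpace 𝓗] {κ : Type*} (c : HilbertBasis κ ℂ 𝓗)
    {T : 𝓗 →L[ℂ] 𝓗} (hT : T.IsPositive) {M : ℝ} (hM : 0 ≤ M)
    (h : ∑' k, ENNReal.ofReal (⟪c k, T (c k)⟫_ℂ).re = ENNReal.ofReal M) :
    ∃ (ι : Type u) (b : HilbertBasis ι ℂ 𝓗) (t : ι → ℝ),
      IsEigenbasis T b t ∧ (∀ i, 0 ≤ t i) ∧ HasSum t M := by
  obtain ⟨ι, b, t, hb⟩ := exists_isEigenbasis hT.isSelfAdjoint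
    (isCompactOperator_of_tsum_inner_ne_top c hT (by simp [h]))
  have ht := hb.nonneg hT
  exact ⟨ι, b, t, hb, ht, hasSum_of_tsum_ofReal_eq ht hM ((hb.tsum_inner_eq ht c).symm.trans h)⟩

theorem IsState.exists_isEigenbasis.{u} {𝓗 : Type u} [NormedAddCommGroup 𝓗]
    [InnerProductSpace ℂ 𝓗] [CompleteSpace 𝓗] {ρ : 𝓗 →L[ℂ] 𝓗} (hρ : IsState ρ) :
    ∃ (ι : Type u) (b : HilbertBasis ι ℂ 𝓗) (t : ι → ℝ),
      IsEigenbasis ρ b t ∧ (∀ i, 0 ≤ t i) ∧ HasSum t 1 := by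
  obtain ⟨w, c, hc⟩ := exists_hilbertBasis ℂ 𝓗
  have hle : ∑' k, ENNReal.ofReal (⟪c k, ρ (c k)⟫_ℂ).re ≤ 1 := by
    rw [← hρ.2]
    refine le_trans ?_
      (le_iSup₂_of_le (Set.range c) c.orthonormal.toSubtypeRange le_rfl)
    rw [tsum_range (fun x => (‖⟪x, ρ x⟫_ℂ‖₊ : ℝ≥0∞)) c.orthonormal.linearIndependent.injective]
    refine ENNReal.tsum_le_tsum fun k => ?_
    rw [← enorm_eq_nnnorm, ← ofReal_norm]
    exact ENNReal.ofReal_le_ofReal (Complex.re_le_norm _)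
  have hne := ne_top_of_le_ne_top ENNReal.one_ne_top hle
  obtain ⟨ι, b, t, hb, ht, hs⟩ := exists_isEigenbasis_of_tsum_inner c hρ.1
    ENNReal.toReal_nonneg (ENNReal.ofReal_toReal hne).symm
  refine ⟨ι, b, t, hb, ht, ?_⟩
  have h1 := hb.trNorm_eq
  simp_rw [abs_of_nonneg (ht _)] at h1
  exact hasSum_of_tsum_ofReal_eq ht zero_le_one (by rw [← h1, hρ.2, ENNReal.ofReal_one])

theorem card_le_of_form_le {ι κ : Type*} {S T : 𝓗 →L[ℂ] 𝓗} {b : HilbertBasis ι ℂ 𝓗} {s : ι → ℝ}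
    {c : HilbertBasis κ ℂ 𝓗} {t : κ → ℝ} (hS : IsEigenbasis S b s) (hT : IsEigenbasis T c t)
    (hST : ∀ x, (⟪x, S x⟫_ℂ).re ≤ (⟪x, T x⟫_ℂ).re) {m : ℝ} {F : Finset ι} {U : Finset κ}
    (hF : ∀ i ∈ F, m ≤ s i) (hU : ∀ k, m ≤ t k → k ∈ U) : F.card ≤ U.card := by
  by_contra! hcard
  let L : (F → ℂ) →ₗ[ℂ] (U → ℂ) :=
    LinearMap.pi fun k => (Fintype.linearCombination ℂ fun i : F => ⟪c k, b i⟫_ℂ)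
  have hker : LinearMap.ker L ≠ ⊥ := LinearMap.ker_ne_bot_of_finrank_lt (by simpa using hcard)
  obtain ⟨a, ha, ha0⟩ := (Submodule.ne_bot_iff _).1 hker
  set x : 𝓗 := ∑ i : F, a i • b i with hx
  have hxU : ∀ k ∈ U, ⟪c k, x⟫_ℂ = 0 := by
    intro k hk
    have := congrFun (LinearMap.mem_ker.1 ha) ⟨k, hk⟩
    simpa [L, hx, Fintype.linearCombination_apply, inner_sum, inner_smul_right] using this
  have hxb : ∀ i, i ∉ F → ⟪b i, x⟫_ℂ = 0 := by
    intro i hi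
    rw [hx, inner_sum]
    refine Finset.sum_eq_zero fun j _ => ?_
    have hij : i ≠ j := fun h => hi (h ▸ j.2)
    rw [inner_smul_right, b.orthonormal.2 hij, mul_zero]
  have hx0 : x ≠ 0 := by
    intro h0
    have hli : LinearIndependent ℂ fun i : F => b i :=
      b.orthonormal.linearIndependent.comp _ Subtype.val_injective
    exact ha0 (funext (Fintype.linearIndependent_iff.1 hli a h0))
  have h1 : m * ‖x‖ ^ 2 ≤ (⟪x, S x⟫_ℂ).re := by
    refine hasSum_le (fun i => ?_) ((hasSum_norm_inner_sq b x).mul_left m) (hS.hasSum_re_inner x)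
    by_cases hi : i ∈ F
    · exact mul_le_mul_of_nonneg_right (hF i hi) (by positivity)
    · simp [hxb i hi]
  have hle : ∀ k, t k * ‖⟪c k, x⟫_ℂ‖ ^ 2 ≤ m * ‖⟪c k, x⟫_ℂ‖ ^ 2 := by
    intro k
    by_cases hk : k ∈ U
    · simp [hxU k hk]
    · exact mul_le_mul_of_nonneg_right (not_le.1 fun h => hk (hU k h)).le (by positivity)
  have h2 : (⟪x, T x⟫_ℂ).re < m * ‖x‖ ^ 2 := by
    obtain ⟨k, hk⟩ : ∃ k, ⟪c k, x⟫_ℂ ≠ 0 := by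
      by_contra! h
      have := (hasSum_norm_inner_sq c x).unique (hasSum_zero.congr_fun fun k => by simp [h])
      simp [hx0] at this
    refine hasSum_lt hle (i := k) ?_ (hT.hasSum_re_inner x)
      ((hasSum_norm_inner_sq c x).mul_left m)
    have hkU : k ∉ U := fun h => hk (hxU k h)
    have := norm_pos_iff.2 hk
    exact mul_lt_mul_of_pos_right (not_le.1 fun h => hkU (hU k h)) (by positivity)
  linarith [hST x]

theorem exists_injective_eigenvalue_le {ι κ : Type*} {S T : 𝓗 →L[ℂ] 𝓗} {b : HilbertBasis ι ℂ 𝓗}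
    {s : ι → ℝ} {c : HilbertBasis κ ℂ 𝓗} {t : κ → ℝ} (hS : IsEigenbasis S b s)
    (hT : IsEigenbasis T c t) (hST : ∀ x, (⟪x, S x⟫_ℂ).re ≤ (⟪x, T x⟫_ℂ).re)
    (ht : Summable t) :
    ∃ f : { i // 0 < s i } → κ, f.Injective ∧ ∀ i, s i.1 ≤ t (f i) := by
  classical
  have hfin : ∀ i : { i // 0 < s i }, {k | s i ≤ t k}.Finite := by
    intro i
    have := ht.tendsto_cofinite_zero.eventually (gt_mem_nhds i.2)
    simpa only [Filter.eventually_cofinite, not_lt] using this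
  have hall := (Finset.all_card_le_biUnion_card_iff_exists_injective
    fun i => (hfin i).toFinset).1 fun F => ?_
  · obtain ⟨f, hf, hle⟩ := hall
    exact ⟨f, hf, fun i => by simpa using hle i⟩
  · rcases F.eq_empty_or_nonempty with rfl | hF
    · simp
    obtain ⟨i₀, hi₀, hmin⟩ := F.exists_min_image (fun i => s i) hF
    rw [← Finset.card_map (Function.Embedding.subtype _)]
    refine card_le_of_form_le hS hT hST (m := s i₀) ?_ fun k hk => ?_
    · intro i hi
      obtain ⟨j, hj, rfl⟩ := Finset.mem_map.1 hi
      exact hmin j hj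
    · exact Finset.mem_biUnion.2 ⟨i₀, hi₀, by simpa using hk⟩

theorem exists_rearrangement_le {ι κ : Type*} {S T : 𝓗 →L[ℂ] 𝓗} {b : HilbertBasis ι ℂ 𝓗}
    {s : ι → ℝ} {c : HilbertBasis κ ℂ 𝓗} {t : κ → ℝ} (hS : IsEigenbasis S b s)
    (hT : IsEigenbasis T c t) (hST : ∀ x, (⟪x, S x⟫_ℂ).re ≤ (⟪x, T x⟫_ℂ).re)
    (hs0 : ∀ i, 0 ≤ s i) (ht0 : ∀ k, 0 ≤ t k) (ht : Summable t) :
    ∃ p : κ → ℝ, (∀ k, 0 ≤ p k) ∧ (∀ k, p k ≤ t k) ∧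
      ∀ F : ℝ → ℝ≥0∞, F 0 = 0 → ∑' k, F (p k) = ∑' i, F (s i) := by
  obtain ⟨f, hf, hle⟩ := exists_injective_eigenvalue_le hS hT hST ht
  set p : κ → ℝ := Function.extend f (fun i => s i) 0 with hp
  have hpf : ∀ i, p (f i) = s i := fun i => hf.extend_apply _ _ i
  have hp0 : ∀ k, k ∉ Set.range f → p k = 0 := fun k hk =>
    Function.extend_apply' _ _ _ fun ⟨i, hi⟩ => hk ⟨i, hi⟩
  refine ⟨p, fun k => ?_, fun k => ?_, fun F hF => ?_⟩
  · by_cases hk : k ∈ Set.range f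
    · obtain ⟨i, rfl⟩ := hk
      rw [hpf]
      exact hs0 i
    · rw [hp0 k hk]
  · by_cases hk : k ∈ Set.range f
    · obtain ⟨i, rfl⟩ := hk
      rw [hpf]
      exact hle i
    · rw [hp0 k hk]
      exact ht0 k
  · rw [← hf.tsum_eq (f := fun k => F (p k))]
    · simp_rw [hpf]
      refine Subtype.val_injective.tsum_eq (f := fun i => F (s i)) fun i hi => ?_
      have : s i ≠ 0 := fun h => hi (by simp [h, hF])
      exact ⟨⟨i, lt_of_le_of_ne (hs0 i) this.symm⟩, rfl⟩
    · intro k hk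
      by_contra h
      exact hk (by simp [hp0 k h, hF])

namespace IsEigenbasis

variable {ι : Type*} {T : 𝓗 →L[ℂ] 𝓗} {b : HilbertBasis ι ℂ 𝓗} {t : ι → ℝ}

theorem isCompactOperator (h : IsEigenbasis T b t) (hT : T.IsPositive) (hs : Summable t) :
    IsCompactOperator T := by
  refine isCompactOperator_of_tsum_inner_ne_top b hT ?_
  simp_rw [h.inner_apply_self, Complex.ofReal_re]
  rw [tsum_ofReal_eq_of_hasSum hs.hasSum (h.nonneg hT)]
  exact ENNReal.ofReal_ne_top

theorem hasSum_re_inner_basis (h : IsEigenbasis T b t) (ht : ∀ i, 0 ≤ t i) {M : ℝ}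
    (hs : HasSum t M) {κ : Type*} (c : HilbertBasis κ ℂ 𝓗) :
    HasSum (fun k => (⟪c k, T (c k)⟫_ℂ).re) M := by
  refine hasSum_of_tsum_ofReal_eq (fun k => ?_) (hs.nonneg ht) ?_
  · exact (h.hasSum_re_inner (c k)).nonneg fun i => mul_nonneg (ht i) (by positivity)
  · rw [h.tsum_inner_eq ht c, tsum_ofReal_eq_of_hasSum hs ht]

theorem entropy_eq (h : IsEigenbasis T b t) (ht : ∀ i, 0 ≤ t i) (hs : HasSum t 1) :
    entropy T = ∑' i, ENNReal.ofReal (eta (t i)) := by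
  rw [entropy, (h.cfc continuous_eta).trNorm_eq]
  refine tsum_congr fun i => ?_
  rw [abs_of_nonneg (eta_nonneg (ht i) (le_hasSum hs i fun j _ => ht j))]

theorem entExt_cut_eq (h : IsEigenbasis T b t) (ht : ∀ i, 0 ≤ t i) (hs : Summable t) {ε : ℝ}
    (hε : 0 < ε) :
    entExt (cut T ε) = ∑' i, ENNReal.ofReal
      (min (t i) ε * Real.log ((∑' j, min (t j) ε) / min (t i) ε)) := by
  have hm0 : ∀ i, 0 ≤ min (t i) ε := fun i => le_min (ht i) hε.le
  have hm := hasSum_min ht hs hε.le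
  set M := ∑' j, min (t j) ε
  have hM0 : 0 ≤ M := hm.nonneg hm0
  have hcut : IsEigenbasis (cut T ε) b fun i => min (t i) ε :=
    h.cfc (continuous_id.min continuous_const)
  have htr : trNorm (cut T ε) = ENNReal.ofReal M := by
    rw [hcut.trNorm_eq, ← tsum_ofReal_eq_of_hasSum hm hm0]
    exact tsum_congr fun i => by rw [abs_of_nonneg (hm0 i)]
  rw [entExt]
  split_ifs with h0
  · refine (ENNReal.tsum_eq_zero.2 fun i => ?_).symm
    have h1 := hcut.inner_apply_self i
    rw [h0] at h1
    have h2 : min (t i) ε = 0 := by simpa using h1.symm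
    simp [h2]
  · have hMpos : 0 < M := by
      refine hM0.lt_of_ne' fun hM => h0 ?_
      have hz : ∀ i, min (t i) ε = 0 := congrFun ((hasSum_zero_iff_of_nonneg hm0).1 (hM ▸ hm))
      refine ContinuousLinearMap.ext_on
        (Submodule.dense_iff_topologicalClosure_eq_top.2 b.dense_span) ?_
      rintro _ ⟨i, rfl⟩
      rw [hcut.apply_eq, hz]
      simp
    rw [htr, ENNReal.toReal_ofReal hM0, entropy,
      ((hcut.smul M⁻¹).cfc continuous_eta).trNorm_eq, ← ENNReal.tsum_mul_left]
    refine tsum_congr fun i => ?_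
    have hle : min (t i) ε ≤ M := le_hasSum hm i fun j _ => hm0 j
    rw [← ENNReal.ofReal_mul hM0, ← mul_eta_inv_mul hMpos, abs_of_nonneg]
    refine eta_nonneg (by have := hm0 i; positivity) ?_
    rw [inv_mul_le_one₀ hMpos]
    exact hle

end IsEigenbasis

theorem exists_majorant_eigenvalues.{u} {𝓗 : Type u} [NormedAddCommGroup 𝓗]
    [InnerProductSpace ℂ 𝓗] [CompleteSpace 𝓗] {ι κ : Type*} {ρ σ : 𝓗 →L[ℂ] 𝓗}
    {b : HilbertBasis ι ℂ 𝓗} {s : ι → ℝ} {c : HilbertBasis κ ℂ 𝓗} {t : κ → ℝ}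
    (hρ : IsEigenbasis ρ b s) (hσ : IsEigenbasis σ c t) (hρ0 : ρ.IsPositive) (hσ0 : σ.IsPositive)
    (hs : HasSum s 1) (ht : HasSum t 1) {ε : ℝ} (hε : 0 ≤ ε)
    (h : trNorm (ρ - σ) ≤ ENNReal.ofReal (2 * ε)) :
    ∃ (K : Type u) (p q : K → ℝ), (∀ k, 0 ≤ p k) ∧ (∀ k, 0 ≤ q k) ∧
      (∀ F : ℝ → ℝ≥0∞, F 0 = 0 → ∑' k, F (p k) = ∑' i, F (s i)) ∧
      (∀ F : ℝ → ℝ≥0∞, F 0 = 0 → ∑' k, F (q k) = ∑' i, F (t i)) ∧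
      ∑' k, max (p k - q k) 0 ≤ ε := by
  have hs0 := hρ.nonneg hρ0
  have ht0 := hσ.nonneg hσ0
  have hsa : IsSelfAdjoint (ρ - σ) := hρ.isSelfAdjoint.sub hσ.isSelfAdjoint
  have hcpt : IsCompactOperator (ρ - σ) :=
    (hρ.isCompactOperator hρ0 hs.summable).sub (hσ.isCompactOperator hσ0 ht.summable)
  obtain ⟨ν, e, d, hd⟩ := exists_isEigenbasis hsa hcpt
  have hσe := hσ.hasSum_re_inner_basis ht0 ht e
  have hdsum : HasSum d 0 := by
    rw [← sub_self (1 : ℝ)]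
    refine ((hρ.hasSum_re_inner_basis hs0 hs e).sub hσe).congr_fun fun n => ?_
    rw [← Complex.sub_re, ← inner_sub_right, ← sub_apply, hd.inner_apply_self, Complex.ofReal_re]
  rw [hd.trNorm_eq] at h
  have habs : HasSum (fun n => |d n|) (∑' n, ENNReal.ofReal |d n|).toReal :=
    hasSum_of_tsum_ofReal_eq (fun n => abs_nonneg _) ENNReal.toReal_nonneg
      (ENNReal.ofReal_toReal (ne_top_of_le_ne_top ENNReal.ofReal_ne_top h)).symm
  have hle := ENNReal.toReal_le_of_le_ofReal (by positivity) h
  set A := (∑' n, ENNReal.ofReal |d n|).toReal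
  have hpos : HasSum (fun n => max (d n) 0) (A / 2) := by
    have := (habs.add hdsum).div_const 2
    rw [add_zero] at this
    refine this.congr_fun fun n => ?_
    rcases le_total 0 (d n) with h | h
    · rw [abs_of_nonneg h, max_eq_left h]; ring
    · rw [abs_of_nonpos h, max_eq_right h]; ring
  have hP := hd.cfc (f := fun x => max x 0) (continuous_id.max continuous_const)
  have hP0 : (cfc (fun x : ℝ => max x 0) (ρ - σ)).IsPositive :=
    (ContinuousLinearMap.nonneg_iff_isPositive _).1 (cfc_nonneg fun x _ => le_max_right _ _)
  set P := cfc (fun x : ℝ => max x 0) (ρ - σ)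
  have hωre : ∀ x, (⟪x, (σ + P) x⟫_ℂ).re = (⟪x, σ x⟫_ℂ).re + (⟪x, P x⟫_ℂ).re := fun x => by
    rw [add_apply, inner_add_right, Complex.add_re]
  have hωsum : HasSum (fun n => (⟪e n, (σ + P) (e n)⟫_ℂ).re) (1 + A / 2) := by
    refine (hσe.add hpos).congr_fun fun n => ?_
    rw [hωre, hP.inner_apply_self, Complex.ofReal_re]
  have hω0 : (σ + P).IsPositive := hσ0.add hP0
  obtain ⟨K, g, w, hω, hw0, hw⟩ := exists_isEigenbasis_of_tsum_inner e hω0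
    (hωsum.nonneg fun n => (Complex.nonneg_iff.1 (hω0.inner_nonneg_right _)).1)
    (tsum_ofReal_eq_of_hasSum hωsum fun n => (Complex.nonneg_iff.1 (hω0.inner_nonneg_right _)).1)
  have hρω : ∀ x, (⟪x, ρ x⟫_ℂ).re ≤ (⟪x, (σ + P) x⟫_ℂ).re := by
    intro x
    have h1 : (⟪x, (ρ - σ) x⟫_ℂ).re ≤ (⟪x, P x⟫_ℂ).re :=
      hasSum_le (fun n => mul_le_mul_of_nonneg_right (le_max_left _ _) (by positivity))
        (hd.hasSum_re_inner x) (hP.hasSum_re_inner x)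
    rw [sub_apply, inner_sub_right, Complex.sub_re] at h1
    rw [hωre]
    linarith
  have hσω : ∀ x, (⟪x, σ x⟫_ℂ).re ≤ (⟪x, (σ + P) x⟫_ℂ).re := by
    intro x
    rw [hωre]
    linarith [(Complex.nonneg_iff.1 (hP0.inner_nonneg_right x)).1]
  obtain ⟨p, hp0, hpw, hp⟩ := exists_rearrangement_le hρ hω hρω hs0 hw0 hw.summable
  obtain ⟨q, hq0, hqw, hq⟩ := exists_rearrangement_le hσ hω hσω ht0 hw0 hw.summable
  refine ⟨K, p, q, hp0, hq0, hp, hq, ?_⟩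
  have hq1 : HasSum q 1 := hasSum_of_tsum_ofReal_eq hq0 zero_le_one
    ((hq _ ENNReal.ofReal_zero).trans (tsum_ofReal_eq_of_hasSum ht ht0))
  have hwq := hw.sub hq1
  have hmax : ∀ k, max (p k - q k) 0 ≤ w k - q k := fun k =>
    max_le (sub_le_sub_right (hpw k) _) (sub_nonneg.2 (hqw k))
  have hsm : Summable fun k => max (p k - q k) 0 :=
    hwq.summable.of_nonneg_of_le (fun k => le_max_right _ _) hmax
  linarith [hasSum_le hmax hsm.hasSum hwq]

end

/-- Proposition 1: faithful lower semicontinuity bound for the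
von Neumann entropy. -/
theorem stmt13
    {𝓗 : Type*} [NormedAddCommGroup 𝓗] [InnerProductSpace ℂ 𝓗] [CompleteSpace 𝓗]
    (ρ : 𝓗 →L[ℂ] 𝓗) (hρ : IsState ρ) (hfin : entropy ρ ≠ ⊤) :
    (∀ σ : 𝓗 →L[ℂ] 𝓗, IsState σ → ∀ ε : ℝ, 0 < ε → ε ≤ 1 →
      trNorm (ρ - σ) ≤ ENNReal.ofReal (2 * ε) →
        entropy ρ ≤ entropy σ + entExt (cut ρ ε) + ENNReal.ofReal (binEntUp ε)) ∧
    Tendsto (fun ε : ℝ => entExt (cut ρ ε) + ENNReal.ofReal (binEntUp ε))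
      (nhdsWithin 0 (Set.Ioi 0)) (nhds 0) := by
  obtain ⟨ι, b, s, hb, hs0, hs⟩ := hρ.exists_isEigenbasis
  constructor
  · intro σ hσ ε hε _ htr
    obtain ⟨κ, c, t, hc, ht0, ht⟩ := hσ.exists_isEigenbasis
    obtain ⟨K, p, q, hp0, hq0, hp, hq, hpq⟩ :=
      exists_majorant_eigenvalues hb hc hρ.1 hσ.1 hs ht hε.le htr
    have hp1 : HasSum p 1 := hasSum_of_tsum_ofReal_eq hp0 zero_le_one
      ((hp _ ENNReal.ofReal_zero).trans (tsum_ofReal_eq_of_hasSum hs hs0))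
    have hq1 : HasSum q 1 := hasSum_of_tsum_ofReal_eq hq0 zero_le_one
      ((hq _ ENNReal.ofReal_zero).trans (tsum_ofReal_eq_of_hasSum ht ht0))
    have hmin := hasSum_min hs0 hs.summable hε.le
    have hmin0 : ∀ i, 0 ≤ min (s i) ε := fun i => le_min (hs0 i) hε.le
    have hM : HasSum (fun k => min (p k) ε) (∑' i, min (s i) ε) := by
      refine hasSum_of_tsum_ofReal_eq (fun k => le_min (hp0 k) hε.le) (hmin.nonneg hmin0) ?_
      rw [hp (fun x => ENNReal.ofReal (min x ε)) (by simp [hε.le]),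
        tsum_ofReal_eq_of_hasSum hmin hmin0]
    rw [hb.entropy_eq hs0 hs, hc.entropy_eq ht0 ht, hb.entExt_cut_eq hs0 hs.summable hε,
      ← hp (fun x => ENNReal.ofReal (eta x)) (by simp [eta]),
      ← hq (fun x => ENNReal.ofReal (eta x)) (by simp [eta]),
      ← hp (fun x => ENNReal.ofReal (min x ε * Real.log ((∑' j, min (s j) ε) / min x ε)))
        (by simp [hε.le])]
    exact tsum_eta_le hp0 hq0 hp1 hq1 hpq hM
  · rw [hb.entropy_eq hs0 hs] at hfin
    rw [← add_zero (0 : ℝ≥0∞)]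
    refine ((tendsto_tsum_mul_log_div_min hs0 hs hfin).congr' ?_).add tendsto_binEntUp
    filter_upwards [self_mem_nhdsWithin] with ε hε
    exact (hb.entExt_cut_eq hs0 hs.summable hε).symm

end AFW
end
end

section
/- Let H = Σ_{k=1}^∞ h_k|τ_k⟩⟨τ_k| be a positive operator on ℋ with discrete spectral representation and let a > 1. Then |E_H(ρ) − E_H(σ)| ≤ ε^{1−1/a}·E^{1/a} for any states ρ and σ in 𝔖(ℋ) such that Tr H^a ρ ≤ E, Tr H^a σ ≤ E and ½‖ρ−σ‖₁ ≤ ε, where E_H(ϱ) := Tr Hϱ. -/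
open scoped ENNReal InnerProductSpace
open MeasureTheory

noncomputable section

namespace AFW

attribute [local instance] Classical.propDecidable

variable {𝓗 : Type*} [NormedAddCommGroup 𝓗] [InnerProductSpace ℂ 𝓗] [CompleteSpace 𝓗]

end AFW

namespace AFW

section Diagonal

variable {𝓗 : Type*} [NormedAddCommGroup 𝓗] [InnerProductSpace ℂ 𝓗]

/-- Parseval's identity for an orthonormal sequence and a vector in its closed span. -/
lemma tsum_enorm_inner_sq_of_mem_closure {τ : ℕ → 𝓗} [CompleteSpace 𝓗] (hτ : Orthonormal ℂ τ) {y : 𝓗}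
    (hy : y ∈ (Submodule.span ℂ (Set.range τ)).topologicalClosure) :
    ∑' k, ENNReal.ofReal (‖⟪τ k, y⟫_ℂ‖ ^ 2) = ENNReal.ofReal (‖y‖ ^ 2) := by
  set K := (Submodule.span ℂ (Set.range τ)).topologicalClosure with hK
  have hmem : ∀ k, τ k ∈ K := fun k =>
    Submodule.le_topologicalClosure _ (Submodule.subset_span ⟨k, rfl⟩)
  have : CompleteSpace K := (Submodule.isClosed_topologicalClosure _).completeSpace_coe
  let v : ℕ → K := fun k => ⟨τ k, hmem k⟩
  have hv : Orthonormal ℂ v := by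
    rw [orthonormal_iff_ite] at hτ ⊢
    exact hτ
  have hdense : (Submodule.span ℂ (Set.range v))ᗮ = ⊥ := by
    rw [Submodule.eq_bot_iff]
    rintro ⟨z, hz⟩ hz'
    have h1 : z ∈ (Submodule.span ℂ (Set.range τ))ᗮ := by
      rw [Submodule.mem_orthogonal]
      intro u hu
      induction hu using Submodule.span_induction with
      | mem x hx =>
        obtain ⟨k, rfl⟩ := hx
        exact (Submodule.mem_orthogonal _ _).1 hz' (v k) (Submodule.subset_span ⟨k, rfl⟩)
      | zero => simp
      | add x y _ _ hx hy => rw [inner_add_left, hx, hy, add_zero]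
      | smul c x _ hx => rw [inner_smul_left, hx, mul_zero]
    rw [← Submodule.orthogonal_closure] at h1
    have h2 : ⟪z, z⟫_ℂ = 0 := (Submodule.mem_orthogonal _ _).1 h1 z hz
    exact Subtype.ext (inner_self_eq_zero.1 h2)
  let b := HilbertBasis.mkOfOrthogonalEqBot hv hdense
  have hb := b.hasSum_inner_mul_inner ⟨y, hy⟩ ⟨y, hy⟩
  have hterm : ∀ k, ⟪(⟨y, hy⟩ : K), b k⟫_ℂ * ⟪b k, (⟨y, hy⟩ : K)⟫_ℂ
      = ((‖⟪τ k, y⟫_ℂ‖ ^ 2 : ℝ) : ℂ) := by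
    intro k
    have : b k = v k := by simp [b]
    rw [this, ← inner_conj_symm, RCLike.conj_mul]
    simp [v]
  simp only [hterm] at hb
  have hself : ⟪(⟨y, hy⟩ : K), (⟨y, hy⟩ : K)⟫_ℂ = ((‖y‖ ^ 2 : ℝ) : ℂ) := by
    rw [inner_self_eq_norm_sq_to_K]; simp
  rw [hself] at hb
  have hb' := Complex.hasSum_ofReal.1 hb
  rw [← ENNReal.ofReal_tsum_of_nonneg (fun _ => by positivity) hb'.summable, hb'.tsum_eq]

/-- Bessel's inequality for the elements of an orthonormal set. -/
lemma tsum_inner_sq_le {s : Set 𝓗} (hs : Orthonormal ℂ (Subtype.val : s → 𝓗)) (y : 𝓗) :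
    ∑' x : s, ENNReal.ofReal (‖⟪(x : 𝓗), y⟫_ℂ‖ ^ 2) ≤ ENNReal.ofReal (‖y‖ ^ 2) := by
  rw [← ENNReal.ofReal_tsum_of_nonneg (fun _ => by positivity) (hs.inner_products_summable y)]
  exact ENNReal.ofReal_le_ofReal (hs.tsum_inner_products_le y)

/-- The trace norm dominates the absolute diagonal sum along any orthonormal sequence. -/
lemma tsum_diag_le_trNorm {τ : ℕ → 𝓗} (hτ : Orthonormal ℂ τ)
    (T : 𝓗 →L[ℂ] 𝓗) : ∑' k, (‖⟪τ k, T (τ k)⟫_ℂ‖₊ : ℝ≥0∞) ≤ trNorm T := by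
  have hinj : Function.Injective τ := hτ.linearIndependent.injective
  have hs : Orthonormal ℂ (Subtype.val : Set.range τ → 𝓗) := hτ.toSubtypeRange
  refine le_trans (le_of_eq ?_) (le_iSup₂ (f := fun (s : Set 𝓗)
    (_ : Orthonormal ℂ (Subtype.val : s → 𝓗)) =>
      ∑' x : s, (‖⟪(x : 𝓗), T x⟫_ℂ‖₊ : ℝ≥0∞)) (Set.range τ) hs)
  exact (tsum_range (fun x : 𝓗 => (‖⟪x, T x⟫_ℂ‖₊ : ℝ≥0∞)) hinj).symm

/-- An operator of finite energy has range in the closed span of the eigenvectors. -/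
lemma range_le_of_energy_ne_top {h : ℕ → ℝ} {τ : ℕ → 𝓗} {ρ : 𝓗 →L[ℂ] 𝓗}
    (hE : energy h τ ρ ≠ ⊤) : LinearMap.range (ρ : 𝓗 →ₗ[ℂ] 𝓗) ≤
      (Submodule.span ℂ (Set.range τ)).topologicalClosure := by
  by_contra hr
  exact hE (if_neg hr)

/-- The energy of an operator supported in the closed span of the eigenvectors is the weighted sum
of its diagonal. -/
lemma energy_eq_tsum {h : ℕ → ℝ} (hh : ∀ k, 0 ≤ h k) {τ : ℕ → 𝓗} {ρ : 𝓗 →L[ℂ] 𝓗}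
    (hr : LinearMap.range (ρ : 𝓗 →ₗ[ℂ] 𝓗) ≤
      (Submodule.span ℂ (Set.range τ)).topologicalClosure) :
    energy h τ ρ
      = ∑' k, ENNReal.ofReal (h k) * ENNReal.ofReal (⟪τ k, ρ (τ k)⟫_ℂ).re := by
  rw [energy, if_pos hr]
  exact tsum_congr fun k => ENNReal.ofReal_mul (hh k)

variable [CompleteSpace 𝓗]

/-- For a positive operator the trace can be computed along any orthonormal sequence whose
closed span contains the range. -/
lemma tsum_diag_eq_trNorm {τ : ℕ → 𝓗} (hτ : Orthonormal ℂ τ) {ρ : 𝓗 →L[ℂ] 𝓗}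
    (hρ : ρ.IsPositive)
    (hr : LinearMap.range (ρ : 𝓗 →ₗ[ℂ] 𝓗) ≤
      (Submodule.span ℂ (Set.range τ)).topologicalClosure) :
    ∑' k, ENNReal.ofReal (⟪τ k, ρ (τ k)⟫_ℂ).re = trNorm ρ := by
  apply le_antisymm
  · refine le_trans (ENNReal.tsum_le_tsum fun k => ?_) (tsum_diag_le_trNorm hτ ρ)
    rw [← enorm_eq_nnnorm, ← ofReal_norm]
    exact ENNReal.ofReal_le_ofReal (Complex.re_le_norm _)
  have hρ0 : 0 ≤ ρ := (ContinuousLinearMap.nonneg_iff_isPositive ρ).2 hρ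
  set B := CFC.sqrt ρ with hB
  have hBB : B * B = ρ := CFC.sqrt_mul_sqrt_self ρ hρ0
  have hBp : B.IsPositive :=
    (ContinuousLinearMap.nonneg_iff_isPositive B).1 (CFC.sqrt_nonneg ρ)
  have hsymm : ∀ x y, ⟪B x, y⟫_ℂ = ⟪x, B y⟫_ℂ := hBp.isSymmetric
  have hquad : ∀ x, ⟪x, ρ x⟫_ℂ = ((‖B x‖ ^ 2 : ℝ) : ℂ) := by
    intro x
    rw [← hBB, mul_apply_eq_comp, ← hsymm, inner_self_eq_norm_sq_to_K]
    simp
  set K := (Submodule.span ℂ (Set.range τ)).topologicalClosure with hK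
  have : CompleteSpace K := (Submodule.isClosed_topologicalClosure _).completeSpace_coe
  have hBr : ∀ x, B x ∈ K := by
    intro x
    rw [← Submodule.orthogonal_orthogonal K, Submodule.mem_orthogonal]
    intro u hu
    have h1 : ⟪u, ρ u⟫_ℂ = 0 :=
      (Submodule.mem_orthogonal' K u).1 hu _ (hr ⟨u, rfl⟩)
    rw [hquad] at h1
    have h2 : B u = 0 := by simpa using h1
    rw [← hsymm, h2, inner_zero_left]
  refine iSup₂_le fun s hs => ?_
  calc ∑' x : s, (‖⟪(x : 𝓗), ρ x⟫_ℂ‖₊ : ℝ≥0∞)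
      = ∑' x : s, ∑' k, ENNReal.ofReal (‖⟪(x : 𝓗), B (τ k)⟫_ℂ‖ ^ 2) := by
        refine tsum_congr fun x => ?_
        rw [← enorm_eq_nnnorm, ← ofReal_norm, hquad, Complex.norm_real,
          Real.norm_of_nonneg (by positivity),
          ← tsum_enorm_inner_sq_of_mem_closure hτ (hBr x)]
        refine tsum_congr fun k => ?_
        rw [← hsymm, norm_inner_symm]
    _ = ∑' k, ∑' x : s, ENNReal.ofReal (‖⟪(x : 𝓗), B (τ k)⟫_ℂ‖ ^ 2) := ENNReal.tsum_comm
    _ ≤ ∑' k, ENNReal.ofReal (‖B (τ k)‖ ^ 2) :=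
        ENNReal.tsum_le_tsum fun k => tsum_inner_sq_le hs _
    _ = ∑' k, ENNReal.ofReal (⟪τ k, ρ (τ k)⟫_ℂ).re := by
        refine tsum_congr fun k => ?_
        rw [hquad, Complex.ofReal_re]

/-- For two sequences with the same finite sum, the sums of positive and negative parts of the
difference agree. -/
lemma tsum_tsub_eq_tsum_tsub {p q : ℕ → ℝ≥0∞} (hpq : ∑' k, p k = ∑' k, q k)
    (hp : ∑' k, p k ≠ ⊤) : ∑' k, (p k - q k) = ∑' k, (q k - p k) := by
  have h : ∑' k, q k + ∑' k, (p k - q k) = ∑' k, p k + ∑' k, (q k - p k) := by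
    rw [← ENNReal.tsum_add, ← ENNReal.tsum_add]
    refine tsum_congr fun k => ?_
    rw [add_tsub_eq_max, add_tsub_eq_max, max_comm]
  rw [← hpq] at h
  exact (ENNReal.add_right_inj hp).1 h

/-- A Hölder-type continuity bound for weighted sums. -/
lemma tsum_mul_le_add_rpow {p q g : ℕ → ℝ≥0∞} {a : ℝ} (ha : 1 < a) {e M : ℝ≥0∞}
    (he : ∑' k, (p k - q k) ≤ e) (hM : ∑' k, g k ^ a * p k ≤ M) :
    ∑' k, g k * p k ≤ ∑' k, g k * q k + e ^ (1 - 1 / a) * M ^ (1 / a) := by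
  have ha0 : 0 < a := by linarith
  have h0 : 0 ≤ 1 / a := by positivity
  have h1 : 0 ≤ 1 - 1 / a := by
    rw [sub_nonneg, div_le_one ha0]; exact ha.le
  have hterm : ∀ k, (p k - q k) ^ (1 - 1 / a) * (g k ^ a * (p k - q k)) ^ (1 / a)
      = g k * (p k - q k) := by
    intro k
    rw [ENNReal.mul_rpow_of_nonneg _ _ h0, ← ENNReal.rpow_mul, mul_one_div_cancel ha0.ne',
      ENNReal.rpow_one, mul_left_comm, ← ENNReal.rpow_add_of_nonneg _ _ h1 h0,
      sub_add_cancel, ENNReal.rpow_one]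
  have hold : ∑' k, g k * (p k - q k)
      ≤ (∑' k, (p k - q k)) ^ (1 - 1 / a) * (∑' k, g k ^ a * (p k - q k)) ^ (1 / a) := by
    have := ENNReal.lintegral_mul_norm_pow_le (μ := Measure.count) (f := fun k => p k - q k)
      (g := fun k => g k ^ a * (p k - q k)) (measurable_of_countable _).aemeasurable
      (measurable_of_countable _).aemeasurable h1 h0 (by ring)
    simpa only [lintegral_count, hterm] using this
  calc ∑' k, g k * p k ≤ ∑' k, (g k * q k + g k * (p k - q k)) := by
        refine ENNReal.tsum_le_tsum fun k => ?_
        rw [← mul_add]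
        gcongr
        exact le_add_tsub
    _ = ∑' k, g k * q k + ∑' k, g k * (p k - q k) := ENNReal.tsum_add
    _ ≤ _ := by
        gcongr
        refine hold.trans ?_
        gcongr
        refine le_trans (ENNReal.tsum_le_tsum fun k => ?_) hM
        gcongr
        exact tsub_le_self

/-- For states supported in the closed span of `τ`, the positive part of the difference of their
diagonals is summable to at most half of the trace-norm distance. -/
lemma tsum_diag_tsub_le {τ : ℕ → 𝓗} (hτ : Orthonormal ℂ τ) {ρ σ : 𝓗 →L[ℂ] 𝓗}
    (hρ : IsState ρ) (hσ : IsState σ)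
    (hrρ : LinearMap.range (ρ : 𝓗 →ₗ[ℂ] 𝓗) ≤
      (Submodule.span ℂ (Set.range τ)).topologicalClosure)
    (hrσ : LinearMap.range (σ : 𝓗 →ₗ[ℂ] 𝓗) ≤
      (Submodule.span ℂ (Set.range τ)).topologicalClosure)
    {ε : ℝ} (hdist : trNorm (ρ - σ) ≤ ENNReal.ofReal (2 * ε)) :
    ∑' k, (ENNReal.ofReal (⟪τ k, ρ (τ k)⟫_ℂ).re - ENNReal.ofReal (⟪τ k, σ (τ k)⟫_ℂ).re)
        ≤ ENNReal.ofReal ε ∧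
      ∑' k, (ENNReal.ofReal (⟪τ k, σ (τ k)⟫_ℂ).re - ENNReal.ofReal (⟪τ k, ρ (τ k)⟫_ℂ).re)
        ≤ ENNReal.ofReal ε := by
  have h1 := (tsum_diag_eq_trNorm hτ hρ.1 hrρ).trans hρ.2
  have h2 := (tsum_diag_eq_trNorm hτ hσ.1 hrσ).trans hσ.2
  have heq := tsum_tsub_eq_tsum_tsub (h1.trans h2.symm) (by rw [h1]; exact ENNReal.one_ne_top)
  rw [← heq, and_self]
  set D := ∑' k, (ENNReal.ofReal (⟪τ k, ρ (τ k)⟫_ℂ).re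
    - ENNReal.ofReal (⟪τ k, σ (τ k)⟫_ℂ).re) with hD
  have hsum : D + D ≤ ENNReal.ofReal (2 * ε) := by
    nth_rewrite 2 [heq]
    rw [hD, ← ENNReal.tsum_add]
    refine le_trans (ENNReal.tsum_le_tsum fun k => ?_) ((tsum_diag_le_trNorm hτ _).trans hdist)
    have hp : 0 ≤ (⟪τ k, ρ (τ k)⟫_ℂ).re := hρ.1.re_inner_nonneg_right _
    have hq : 0 ≤ (⟪τ k, σ (τ k)⟫_ℂ).re := hσ.1.re_inner_nonneg_right _
    rw [← ENNReal.ofReal_sub _ hq, ← ENNReal.ofReal_sub _ hp, ← enorm_eq_nnnorm,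
      ← ofReal_norm]
    have habs : |(⟪τ k, ρ (τ k)⟫_ℂ).re - (⟪τ k, σ (τ k)⟫_ℂ).re|
        ≤ ‖⟪τ k, (ρ - σ) (τ k)⟫_ℂ‖ := by
      rw [sub_apply, inner_sub_right, ← Complex.sub_re]
      exact Complex.abs_re_le_norm _
    rcases le_total (⟪τ k, σ (τ k)⟫_ℂ).re (⟪τ k, ρ (τ k)⟫_ℂ).re with hle | hle
    · rw [ENNReal.ofReal_of_nonpos (sub_nonpos.2 hle), add_zero]
      exact ENNReal.ofReal_le_ofReal ((le_abs_self _).trans habs)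
    · rw [ENNReal.ofReal_of_nonpos (sub_nonpos.2 hle), zero_add]
      exact ENNReal.ofReal_le_ofReal ((neg_sub _ _).symm.le.trans ((neg_le_abs _).trans habs))
  rw [ENNReal.ofReal_mul zero_le_two, ENNReal.ofReal_ofNat, ← two_mul] at hsum
  exact (ENNReal.mul_le_mul_iff_right two_ne_zero ENNReal.ofNat_ne_top).1 hsum

end Diagonal

/-- Corollary 4: continuity bound for `E_H` on `𝔠_{H^a,E}`. -/
theorem stmt16
    {𝓗 : Type*} [NormedAddCommGroup 𝓗] [InnerProductSpace ℂ 𝓗] [CompleteSpace 𝓗]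
    (h : ℕ → ℝ) (τ : ℕ → 𝓗) (hop : DiscreteOp h τ)
    (hunbdd : Filter.Tendsto h Filter.atTop Filter.atTop)
    (a : ℝ) (ha : 1 < a) (E : ℝ)
    (ρ σ : 𝓗 →L[ℂ] 𝓗) (hρ : IsState ρ) (hσ : IsState σ)
    (hEρ : energy (fun k => h k ^ a) τ ρ ≤ ENNReal.ofReal E)
    (hEσ : energy (fun k => h k ^ a) τ σ ≤ ENNReal.ofReal E)
    (ε : ℝ) (hε0 : 0 ≤ ε) (hdist : trNorm (ρ - σ) ≤ ENNReal.ofReal (2 * ε)) :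
    energy h τ ρ ≤ energy h τ σ
        + ENNReal.ofReal ε ^ (1 - 1 / a) * ENNReal.ofReal E ^ (1 / a) ∧
    energy h τ σ ≤ energy h τ ρ
        + ENNReal.ofReal ε ^ (1 - 1 / a) * ENNReal.ofReal E ^ (1 / a) := by
  have hrρ := range_le_of_energy_ne_top (ne_top_of_le_ne_top ENNReal.ofReal_ne_top hEρ)
  have hrσ := range_le_of_energy_ne_top (ne_top_of_le_ne_top ENNReal.ofReal_ne_top hEσ)
  obtain ⟨h1, h2⟩ := tsum_diag_tsub_le hop.ortho hρ hσ hrρ hrσ hdist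
  have hpow : ∀ k, 0 ≤ h k ^ a := fun k => Real.rpow_nonneg (hop.nonneg k) a
  rw [energy_eq_tsum hpow hrρ] at hEρ
  rw [energy_eq_tsum hpow hrσ] at hEσ
  simp only [← ENNReal.ofReal_rpow_of_nonneg (hop.nonneg _) (zero_le_one.trans ha.le)]
    at hEρ hEσ
  rw [energy_eq_tsum hop.nonneg hrρ, energy_eq_tsum hop.nonneg hrσ]
  exact ⟨tsum_mul_le_add_rpow ha h1 hEρ, tsum_mul_le_add_rpow ha h2 hEσ⟩


end AFW
end
end
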